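/- Let g: ℝ^m → ℝ^q be twice continuously differentiable, Γ := {y ∈ ℝ^m | g(y) ≤ 0}, ȳ ∈ Γ, and suppose the metric subregularity constraint qualification holds for the system g(y) ≤ 0 at ȳ. Then there is a neighborhood V of ȳ such that for every (y, y*) ∈ gph N̂_Γ with y ∈ V the following holds: if (w*, w) ∈ N̂_{gph N̂_Γ}(y, y*), then w ∈ K(y, y*) and ⟨w*, w⟩ + w^T ∇²(λ^T g)(y) w ≤ 0 for every λ ∈ Λ(y, y*; w). -/

import Mathlib

open Filter Topology Set
open scoped RealInnerProductSpace

noncomputable section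

/-- `ℝ^d` as a Euclidean space. -/
abbrev Eu (d : ℕ) := EuclideanSpace ℝ (Fin d)

/-- The (Bouligand–Severi) tangent/contingent cone to `Ω` at `z`. -/
def tcone {E : Type*} [NormedAddCommGroup E] [NormedSpace ℝ E] (Ω : Set E) (z : E) : Set E :=
  {u | ∃ t : ℕ → ℝ, ∃ w : ℕ → E, (∀ k, 0 < t k) ∧
    Tendsto t atTop (𝓝 0) ∧ Tendsto w atTop (𝓝 u) ∧ ∀ k, z + t k • w k ∈ Ω}

/-- The (Fréchet) regular normal cone to `Ω` at `zb`. -/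
def rnc {E : Type*} [NormedAddCommGroup E] [InnerProductSpace ℝ E]
    (Ω : Set E) (zb : E) : Set E :=
  {v | ∀ ε > (0 : ℝ), ∃ δ > (0 : ℝ), ∀ z ∈ Ω, ‖z - zb‖ < δ →
    ⟪v, z - zb⟫ ≤ ε * ‖z - zb‖}

/-- Metric subregularity of a set-valued map at a point of its graph. -/
def msr {E F : Type*} [NormedAddCommGroup E] [NormedAddCommGroup F]
    (M : E → Set F) (zb : E) (wb : F) : Prop :=
  ∃ κ : ℝ, 0 < κ ∧ ∃ W ∈ 𝓝 zb, ∀ z ∈ W,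
    EMetric.infEdist z {z' | wb ∈ M z'} ≤ ENNReal.ofReal κ * EMetric.infEdist wb (M z)

/-- The lower-level feasible set `Γ = {y | g(y) ≤ 0}`. -/
def Gam {m q : ℕ} (g : Eu m → Eu q) : Set (Eu m) := {y | ∀ i, g y i ≤ 0}

/-- The multiplier set `Λ(y, y*) = {λ ≥ 0 | ∇g(y)ᵀλ = y*, λ_i = 0 for i ∉ I(y)}`. -/
def Lam {m q : ℕ} (g : Eu m → Eu q) (y ys : Eu m) : Set (Eu q) :=
  {l | (∀ i, 0 ≤ l i) ∧ ContinuousLinearMap.adjoint (fderiv ℝ g y) l = ys ∧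
    ∀ i, g y i ≠ 0 → l i = 0}

/-- The critical cone `K(y, y*) = T_Γ(y) ∩ {y*}ᗮ`. -/
def Kcone {m q : ℕ} (g : Eu m → Eu q) (y ys : Eu m) : Set (Eu m) :=
  tcone (Gam g) y ∩ {v | ⟪v, ys⟫ = 0}

/-- The convex-analysis normal cone to a (convex) set `Ω` at `z`. -/
def cnc {E : Type*} [NormedAddCommGroup E] [InnerProductSpace ℝ E]
    (Ω : Set E) (z : E) : Set E :=
  {w | ∀ z' ∈ Ω, ⟪w, z' - z⟫ ≤ 0}

/-- `∇²(λᵀg)(y) v`, the Hessian of `y ↦ ⟨λ, g(y)⟩` applied to `v`, realized as the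
derivative at `y` of the gradient map `y' ↦ ∇g(y')ᵀλ` in the direction `v`. -/
def hessA {m q : ℕ} (g : Eu m → Eu q) (l : Eu q) (y v : Eu m) : Eu m :=
  fderiv ℝ (fun y' => ContinuousLinearMap.adjoint (fderiv ℝ g y') l) y v

/-- The directional multiplier set
`Λ(y, y*; v) = argmax {vᵀ∇²(λᵀg)(y)v | λ ∈ Λ(y, y*)}`. -/
def dirLam {m q : ℕ} (g : Eu m → Eu q) (y ys v : Eu m) : Set (Eu q) :=
  {l | l ∈ Lam g y ys ∧ ∀ l' ∈ Lam g y ys, ⟪v, hessA g l' y v⟫ ≤ ⟪v, hessA g l y v⟫}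

/-- The extreme points `E(y, y*)` of `Λ(y, y*)`: those multipliers `λ` for which the
active gradients `{∇g_i(y) | λ_i > 0}` are linearly independent. -/
def ExtPts {m q : ℕ} (g : Eu m → Eu q) (y ys : Eu m) : Set (Eu q) :=
  {l | l ∈ Lam g y ys ∧
    LinearIndependent ℝ (fun i : {i : Fin q // 0 < l i} =>
      fderiv ℝ (fun y' => g y' i.1) y)}

/-- The graph of the regular normal cone map `y ↦ N̂_Γ(y)`. -/
def gphN {m q : ℕ} (g : Eu m → Eu q) : Set (Eu m × Eu m) :=
  {p | p.1 ∈ Gam g ∧ p.2 ∈ rnc (Gam g) p.1}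

/-- MSCQ for the lower-level system `g(y) ≤ 0` at `yb`: metric subregularity of
`y ↦ g(y) − ℝ^q₋` at `(yb, 0)`. -/
def MSCQlow {m q : ℕ} (g : Eu m → Eu q) (yb : Eu m) : Prop :=
  msr (fun y => {w : Eu q | ∀ i, g y i - w i ≤ 0}) yb 0

/-- The (Fréchet) regular normal cone to a subset of a product of two real inner product
spaces (the pairing is the sum of the component inner products; the defining `limsup ≤ 0`
condition does not depend on the choice of equivalent norm on the product). -/
def rnc2 {E F : Type*} [NormedAddCommGroup E] [InnerProductSpace ℝ E]
    [NormedAddCommGroup F] [InnerProductSpace ℝ F]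
    (Ω : Set (E × F)) (zb : E × F) : Set (E × F) :=
  {v | ∀ ε > (0 : ℝ), ∃ δ > (0 : ℝ), ∀ z ∈ Ω, ‖z - zb‖ < δ →
    ⟪v.1, z.1 - zb.1⟫ + ⟪v.2, z.2 - zb.2⟫ ≤ ε * ‖z - zb‖}

/-- Approximate strong duality: if `l` maximizes `∑ l i * c i` among the nonnegative solutions of
`∑ l' i • a i = ∑ l i • a i`, the dual program has `δ`-feasible, `δ`-optimal points. -/
theorem exists_approx_dual_of_isMax {ι E : Type*} [Fintype ι] [NormedAddCommGroup E]
    [InnerProductSpace ℝ E] (a : ι → E) (c l : ι → ℝ) (hl : ∀ i, 0 ≤ l i)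
    (hmax : ∀ l' : ι → ℝ, (∀ i, 0 ≤ l' i) → ∑ i, l' i • a i = ∑ i, l i • a i →
      ∑ i, l' i * c i ≤ ∑ i, l i * c i) {δ : ℝ} (hδ : 0 < δ) :
    ∃ z : E, (∀ i, ⟪a i, z⟫ + c i ≤ δ) ∧ -δ ≤ ∑ i, l i * (⟪a i, z⟫ + c i) := by
  classical
  set Y := ∑ i, l i • a i with hY
  set C : Set ((ι → ℝ) × ℝ) := {p | ∃ z : E, (∀ i, ⟪a i, z⟫ ≤ p.1 i) ∧ p.2 ≤ ⟪Y, z⟫} with hC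
  have hYz : ∀ z, ⟪Y, z⟫ = ∑ i, l i * ⟪a i, z⟫ := fun z => by
    simp [hY, sum_inner, real_inner_smul_left]
  set x₀ : (ι → ℝ) × ℝ := (fun i => -c i, -∑ i, l i * c i) with hx₀
  have hconv : Convex ℝ C := by
    rintro p ⟨z, hz, hz'⟩ p' ⟨z', hp, hp'⟩ s t hs ht -
    refine ⟨s • z + t • z', fun i => ?_, ?_⟩
    · simp only [inner_add_right, real_inner_smul_right, Prod.fst_add, Prod.smul_fst,
        Pi.add_apply, Pi.smul_apply, smul_eq_mul]
      gcongr
      exacts [hz i, hp i]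
    · simp only [inner_add_right, real_inner_smul_right, Prod.snd_add, Prod.smul_snd, smul_eq_mul]
      gcongr
  have hcl : x₀ ∈ closure C := by
    by_contra hx
    obtain ⟨f, u, hfu, hux⟩ := geometric_hahn_banach_closed_point hconv.closure isClosed_closure hx
    have hu : 0 < u := by
      have : (0 : (ι → ℝ) × ℝ) ∈ C := ⟨0, by simp, by simp⟩
      simpa using hfu 0 (subset_closure this)
    have hcone : ∀ p ∈ C, f p ≤ 0 := by
      rintro p ⟨z, hz, hz'⟩
      by_contra! hp
      have hk : 0 ≤ u / f p := by positivity
      have : (u / f p) • p ∈ C := by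
        refine ⟨(u / f p) • z, fun i => ?_, ?_⟩
        · simpa [real_inner_smul_right] using mul_le_mul_of_nonneg_left (hz i) hk
        · simpa [real_inner_smul_right] using mul_le_mul_of_nonneg_left hz' hk
      have h := hfu _ (subset_closure this)
      rw [map_smul, smul_eq_mul, div_mul_cancel₀ _ hp.ne'] at h
      exact lt_irrefl _ h
    set μ : ι → ℝ := fun i => f (Pi.single i 1, 0) with hμ
    set α : ℝ := f (0, 1) with hα
    have hf : ∀ v r, f (v, r) = ∑ i, v i * μ i + r * α := by
      intro v r
      have h1 : ((v, r) : (ι → ℝ) × ℝ)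
          = ∑ i, v i • ((Pi.single i 1, 0) : (ι → ℝ) × ℝ) + r • ((0, 1) : (ι → ℝ) × ℝ) := by
        ext i
        · simp [Prod.fst_sum, Finset.sum_apply, Pi.single_apply]
        · simp [Prod.snd_sum]
      rw [h1, map_add, map_sum]
      simp only [map_smul, smul_eq_mul, hμ, hα]
    have hμ0 : ∀ i, μ i ≤ 0 := fun i => hcone _
      ⟨0, fun j => by simp only [inner_zero_right, Pi.single_apply]; split_ifs <;> norm_num, by simp⟩
    have hα0 : 0 ≤ α := by
      have := hcone (0, -1) ⟨0, by simp, by simp⟩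
      rw [hf] at this
      simp at this
      linarith
    have hlin : ∀ z, ⟪∑ i, μ i • a i + α • Y, z⟫ ≤ 0 := by
      intro z
      have := hcone (fun i => ⟪a i, z⟫, ⟪Y, z⟫) ⟨z, fun i => le_rfl, le_rfl⟩
      rw [hf] at this
      simpa [inner_add_left, sum_inner, real_inner_smul_left, mul_comm] using this
    have hzero : ∑ i, μ i • a i + α • Y = 0 :=
      inner_self_eq_zero.1 (le_antisymm (hlin _) real_inner_self_nonneg)
    have h1α : (0 : ℝ) < 1 + α := by linarith
    have key := hmax (fun i => (1 + α)⁻¹ * (l i - μ i))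
      (fun i => mul_nonneg (by positivity) (by linarith [hl i, hμ0 i])) (by
        simp only [mul_smul, sub_smul, ← Finset.smul_sum, Finset.sum_sub_distrib]
        rw [inv_smul_eq_iff₀ h1α.ne', ← hY, add_smul, one_smul, sub_eq_add_neg,
          eq_neg_of_add_eq_zero_left hzero, neg_neg])
    simp only [mul_assoc, ← Finset.mul_sum, sub_mul, Finset.sum_sub_distrib] at key
    rw [inv_mul_le_iff₀ h1α] at key
    rw [hx₀, hf] at hux
    simp only [neg_mul, Finset.sum_neg_distrib] at hux
    simp only [mul_comm (c _)] at hux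
    linarith
  obtain ⟨p, ⟨z, hz, hz'⟩, hp⟩ := Metric.mem_closure_iff.1 hcl δ hδ
  rw [Prod.dist_eq, max_lt_iff] at hp
  refine ⟨z, fun i => ?_, ?_⟩
  · have := (abs_lt.1 ((dist_le_pi_dist _ _ i).trans_lt hp.1)).1
    simp only [hx₀] at this
    linarith [hz i]
  · have := (abs_lt.1 (hp.2 : |_| < _)).2
    simp only [hx₀] at this
    simp only [mul_add, Finset.sum_add_distrib, ← hYz]
    linarith

/-- Second-order Taylor expansion of a curve whose derivative is differentiable at `0`. -/
theorem isLittleO_sq_of_hasDerivAt {F : Type*} [NormedAddCommGroup F] [NormedSpace ℝ F]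
    {f f' : ℝ → F} {v : F} (hf : ∀ t, HasDerivAt f (f' t) t) (hf' : HasDerivAt f' v 0) :
    (fun t : ℝ => f t - f 0 - t • f' 0 - (t ^ 2 / 2) • v) =o[𝓝 0] fun t : ℝ => t ^ 2 := by
  rw [Asymptotics.isLittleO_iff]
  intro ε hε
  have h0 := (hasDerivAt_iff_isLittleO_nhds_zero.1 hf').def hε
  obtain ⟨r, hr, hball⟩ := Metric.eventually_nhds_iff_ball.1 h0
  refine Metric.eventually_nhds_iff_ball.2 ⟨r, hr, fun t ht => ?_⟩
  have hd : ∀ s, HasDerivAt (fun t : ℝ => f t - f 0 - t • f' 0 - (t ^ 2 / 2) • v)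
      (f' s - f' 0 - s • v) s := by
    intro s
    have h1 := (((hf s).sub_const (f 0)).sub ((hasDerivAt_id s).smul_const (f' 0))).sub
      (((hasDerivAt_pow 2 s).div_const 2).smul_const v)
    convert h1 using 1
    · rfl
    · simp
  have hsub : ∀ s ∈ segment ℝ 0 t, ‖s‖ ≤ ‖t‖ := by
    intro s hs
    obtain ⟨a, ha, rfl⟩ := (segment_eq_image ℝ (0 : ℝ) t) ▸ hs
    simp only [smul_eq_mul, mul_zero, zero_add, norm_mul, Real.norm_eq_abs, abs_of_nonneg ha.1]
    exact mul_le_of_le_one_left (abs_nonneg t) ha.2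
  have := (convex_segment (0 : ℝ) t).norm_image_sub_le_of_norm_hasDerivWithin_le (C := ε * ‖t‖)
    (fun s _ => (hd s).hasDerivWithinAt) (fun s hs => ?_) (left_mem_segment ℝ 0 t)
    (right_mem_segment ℝ 0 t)
  · simpa [pow_two, mul_assoc] using this
  · have h2 := hball s (by
      rw [mem_ball_zero_iff] at ht ⊢
      exact (hsub s hs).trans_lt ht)
    rw [zero_add] at h2
    exact h2.trans (by gcongr; exact hsub s hs)

theorem MSCQlow.exists_error_bound {m q : ℕ} {g : Eu m → Eu q} {yb : Eu m} (h : MSCQlow g yb) :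
    ∃ κ : ℝ, 0 < κ ∧ ∃ W ∈ 𝓝 yb, ∀ z ∈ W, ∀ r : ℝ, 0 < r → (∀ i, g z i ≤ r) →
      ∃ z' ∈ Gam g, ‖z' - z‖ ≤ κ * r := by
  obtain ⟨κ, hκ, W, hW, hb⟩ := h
  refine ⟨κ * (√q + 1), by positivity, W, hW, fun z hz r hr hg => ?_⟩
  have hset : {z' | (0 : Eu q) ∈ {w : Eu q | ∀ i, g z' i - w i ≤ 0}} = Gam g := by
    ext z'; simp [Gam]
  have hb := hb z hz
  rw [hset] at hb
  set u : Eu q := WithLp.toLp 2 fun i => max (g z i) 0 with hu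
  have hun : ‖u‖ ≤ √q * r := by
    rw [EuclideanSpace.norm_eq, ← Real.sqrt_sq hr.le, ← Real.sqrt_mul (by positivity)]
    apply Real.sqrt_le_sqrt
    calc ∑ i, ‖u i‖ ^ 2 ≤ ∑ _i : Fin q, r ^ 2 := by
          gcongr with i
          rw [Real.norm_eq_abs, abs_of_nonneg (le_max_right _ _)]
          exact max_le (hg i) hr.le
      _ = q * r ^ 2 := by simp
  have h1 : Metric.infEDist (0 : Eu q) {w : Eu q | ∀ i, g z i - w i ≤ 0}
      ≤ ENNReal.ofReal (√q * r) := by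
    refine (Metric.infEDist_le_edist_of_mem (y := u) (by simp [hu])).trans ?_
    rw [edist_dist, dist_zero_left]
    exact ENNReal.ofReal_le_ofReal hun
  have h2 : Metric.infEDist z (Gam g) < ENNReal.ofReal (κ * (√q + 1) * r) := by
    refine (hb.trans (mul_le_mul_right h1 _)).trans_lt ?_
    rw [← ENNReal.ofReal_mul hκ.le, ENNReal.ofReal_lt_ofReal_iff (by positivity)]
    nlinarith [mul_pos hκ hr]
  obtain ⟨z', hz', hlt⟩ := Metric.infEDist_lt_iff.1 h2
  refine ⟨z', hz', ?_⟩
  rw [edist_dist, dist_comm, dist_eq_norm] at hlt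
  exact ((ENNReal.ofReal_lt_ofReal_iff (by positivity)).1 hlt).le

theorem eventually_exists_mem_Gam_near {α : Type*} {F : Filter α} {m q : ℕ} {g : Eu m → Eu q}
    (hg : Continuous g) {y : Eu m} (hy : y ∈ Gam g) {κ : ℝ} {W : Set (Eu m)} (hW : W ∈ 𝓝 y)
    (hκ : ∀ z ∈ W, ∀ r : ℝ, 0 < r → (∀ i, g z i ≤ r) → ∃ z' ∈ Gam g, ‖z' - z‖ ≤ κ * r)
    {p : α → Eu m} (hp : Tendsto p F (𝓝 y)) {r : α → ℝ} (hr : ∀ᶠ t in F, 0 < r t)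
    (hpr : ∀ᶠ t in F, ∀ i, g y i = 0 → g (p t) i ≤ r t) :
    ∀ᶠ t in F, ∃ x ∈ Gam g, ‖x - p t‖ ≤ κ * r t := by
  have hin : ∀ᶠ t in F, ∀ i, g y i ≠ 0 → g (p t) i < 0 := by
    refine eventually_all.2 fun i => ?_
    by_cases hi : g y i = 0
    · simp [hi]
    · have hc : Continuous fun x => g x i := by fun_prop
      filter_upwards [((hc.tendsto y).comp hp).eventually_lt_const ((hy i).lt_of_ne hi)]
        with t ht _ using ht
  filter_upwards [hp.eventually_mem hW, hr, hpr, hin] with t h1 h2 h3 h4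
  refine hκ _ h1 _ h2 fun i => ?_
  by_cases hi : g y i = 0
  · exact h3 i hi
  · exact (h4 i hi).le.trans h2.le

theorem isLittleO_sq_comp_quadratic {E F : Type*} [NormedAddCommGroup E] [NormedSpace ℝ E]
    [NormedAddCommGroup F] [NormedSpace ℝ F] {g : E → F} (hg : ContDiff ℝ 2 g) (y w z : E) :
    (fun t : ℝ => g (y + t • w + (t ^ 2 / 2) • z) - g y - t • fderiv ℝ g y w
      - (t ^ 2 / 2) • (fderiv ℝ (fderiv ℝ g) y w w + fderiv ℝ g y z))
      =o[𝓝 0] fun t : ℝ => t ^ 2 := by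
  have hp : ∀ t : ℝ, HasDerivAt (fun t : ℝ => y + t • w + (t ^ 2 / 2) • z) (w + t • z) t := by
    intro t
    have := (((hasDerivAt_id t).smul_const w).const_add y).add
      (((hasDerivAt_pow 2 t).div_const 2).smul_const z)
    convert this using 1
    · rfl
    · simp
  have hd : ∀ x, HasFDerivAt g (fderiv ℝ g x) x := fun x =>
    (hg.differentiable (by norm_num) x).hasFDerivAt
  have hd2 : HasFDerivAt (fderiv ℝ g) (fderiv ℝ (fderiv ℝ g) y) y :=
    ((hg.fderiv_right (m := 1) (by norm_num)).differentiable (by norm_num) y).hasFDerivAt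
  have h1 := fun t => (hd _).comp_hasDerivAt t (hp t)
  have h2 : HasDerivAt (fun t : ℝ => fderiv ℝ g (y + t • w + (t ^ 2 / 2) • z))
      (fderiv ℝ (fderiv ℝ g) y w) 0 := by
    have := hd2.comp_hasDerivAt_of_eq (0 : ℝ) (hp 0) (by simp)
    rw [zero_smul, add_zero] at this
    exact this
  have h3 : HasDerivAt (fun t : ℝ => w + t • z) z 0 := by
    simpa using ((hasDerivAt_id (0 : ℝ)).smul_const z).const_add w
  have := isLittleO_sq_of_hasDerivAt h1 (h2.clm_apply h3)
  simpa using this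

theorem mem_rnc_of_isLocalMaxOn {E : Type*} [NormedAddCommGroup E] [InnerProductSpace ℝ E]
    {Ω : Set E} {φ : E → ℝ} {z v : E} (hφ : HasFDerivAt φ (innerSL ℝ v) z)
    (hmax : IsLocalMaxOn φ Ω z) : v ∈ rnc Ω z := by
  intro ε hε
  have h1 := hφ.isLittleO.def hε
  have h2 := eventually_nhdsWithin_iff.1 hmax
  obtain ⟨δ, hδ, h⟩ := Metric.eventually_nhds_iff.1 (h1.and h2)
  refine ⟨δ, hδ, fun u hu hud => ?_⟩
  obtain ⟨h3, h4⟩ := h (by rwa [dist_eq_norm])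
  have h5 := (abs_le.1 h3).1
  simp only [innerSL_apply_apply] at h5
  linarith [h4 hu]

section System

variable {m q : ℕ} {g : Eu m → Eu q}

theorem hasFDerivAt_adjoint_fderiv (hg : ContDiff ℝ 2 g) (l : Eu q) (y : Eu m) :
    HasFDerivAt (fun x => ContinuousLinearMap.adjoint (fderiv ℝ g x) l)
      (fderiv ℝ (fun x => ContinuousLinearMap.adjoint (fderiv ℝ g x) l) y) y := by
  let L : (Eu m →L[ℝ] Eu q) →ₗ[ℝ] Eu m :=
    { toFun := fun B => ContinuousLinearMap.adjoint B l
      map_add' := by simp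
      map_smul' := by simp }
  have h : Differentiable ℝ (fderiv ℝ g) :=
    (hg.fderiv_right (m := 1) (by norm_num)).differentiable (by norm_num)
  exact (L.toContinuousLinearMap.differentiableAt.comp y (h y)).hasFDerivAt

theorem inner_hessA (hg : ContDiff ℝ 2 g) (l : Eu q) (y v u : Eu m) :
    ⟪u, hessA g l y v⟫ = ⟪l, fderiv ℝ (fderiv ℝ g) y v u⟫ := by
  have h1 := (innerSL ℝ u).hasFDerivAt.comp y (hasFDerivAt_adjoint_fderiv hg l y)
  have hd2 : HasFDerivAt (fderiv ℝ g) (fderiv ℝ (fderiv ℝ g) y) y :=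
    ((hg.fderiv_right (m := 1) (by norm_num)).differentiable (by norm_num) y).hasFDerivAt
  have h2 := (innerSL ℝ l).hasFDerivAt.comp y (hd2.clm_apply (hasFDerivAt_const u y))
  have h3 : (innerSL ℝ u) ∘ (fun x => ContinuousLinearMap.adjoint (fderiv ℝ g x) l)
      = (innerSL ℝ l) ∘ fun x => fderiv ℝ g x u := by
    ext x
    simp only [Function.comp_apply, innerSL_apply_apply,
      ContinuousLinearMap.adjoint_inner_right]
    exact real_inner_comm _ _
  rw [h3] at h1
  have := congrArg (fun f => f v) (h1.unique h2)
  simpa [hessA] using this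

theorem hasFDerivAt_inner_comp (hg : Differentiable ℝ g) (l : Eu q) (y : Eu m) :
    HasFDerivAt (fun x => ⟪l, g x⟫)
      (innerSL ℝ (ContinuousLinearMap.adjoint (fderiv ℝ g y) l)) y := by
  have h : innerSL ℝ (ContinuousLinearMap.adjoint (fderiv ℝ g y) l)
      = (innerSL ℝ l).comp (fderiv ℝ g y) := by
    ext v
    simp [ContinuousLinearMap.adjoint_inner_left]
  rw [h]
  exact (innerSL ℝ l).hasFDerivAt.comp y (hg y).hasFDerivAt

theorem adjoint_eq_sum (A : Eu m →L[ℝ] Eu q) (l : Eu q) :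
    ContinuousLinearMap.adjoint A l
      = ∑ i, l i • ContinuousLinearMap.adjoint A (EuclideanSpace.single i 1) := by
  simp only [← map_smul, ← map_sum]
  congr 1
  ext j
  simp [Finset.sum_apply, Pi.single_apply]

theorem inner_single_one (i : Fin q) (v : Eu q) :
    ⟪(EuclideanSpace.single i 1 : Eu q), v⟫ = v i :=
  (EuclideanSpace.inner_single_left i (1 : ℝ) v).trans (by simp)

theorem inner_adjoint_single (A : Eu m →L[ℝ] Eu q) (i : Fin q) (z : Eu m) :
    ⟪ContinuousLinearMap.adjoint A (EuclideanSpace.single i 1), z⟫ = A z i := by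
  rw [ContinuousLinearMap.adjoint_inner_left, inner_single_one]

theorem adjoint_single_mem_rnc (hg : Differentiable ℝ g) {y : Eu m} {i : Fin q}
    (hi : g y i = 0) :
    ContinuousLinearMap.adjoint (fderiv ℝ g y) (EuclideanSpace.single i 1) ∈ rnc (Gam g) y := by
  refine mem_rnc_of_isLocalMaxOn (hasFDerivAt_inner_comp hg (EuclideanSpace.single i 1) y) ?_
  filter_upwards [self_mem_nhdsWithin] with x hx
  simpa only [inner_single_one, hi] using hx i

theorem add_smul_mem_rnc {E : Type*} [NormedAddCommGroup E] [InnerProductSpace ℝ E]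
    {Ω : Set E} {z u v : E} (hu : u ∈ rnc Ω z) (hv : v ∈ rnc Ω z) {s t : ℝ} (hs : 0 ≤ s)
    (ht : 0 ≤ t) : s • u + t • v ∈ rnc Ω z := by
  intro ε hε
  obtain ⟨δ, hδ, h1⟩ := hu (ε / (s + t + 1)) (by positivity)
  obtain ⟨δ', hδ', h2⟩ := hv (ε / (s + t + 1)) (by positivity)
  refine ⟨min δ δ', lt_min hδ hδ', fun x hx hxd => ?_⟩
  have h1 := mul_le_mul_of_nonneg_left (h1 x hx (hxd.trans_le (min_le_left _ _))) hs
  have h2 := mul_le_mul_of_nonneg_left (h2 x hx (hxd.trans_le (min_le_right _ _))) ht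
  rw [inner_add_left, real_inner_smul_left, real_inner_smul_left]
  refine (add_le_add h1 h2).trans ?_
  have h3 : 0 ≤ ε / (s + t + 1) * ‖x - z‖ := by positivity
  have h4 : ε * ‖x - z‖ = (s + t + 1) * (ε / (s + t + 1) * ‖x - z‖) := by field_simp
  rw [h4]
  linarith

theorem inner_le_of_mem_rnc2 {y ys ws w v : Eu m} (hw : (ws, w) ∈ rnc2 (gphN g) (y, ys))
    {τ : ℝ} (hτ : 0 < τ) (hv : ∀ t, 0 < t → t ≤ τ → (y, ys + t • v) ∈ gphN g) : ⟪w, v⟫ ≤ 0 := by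
  have hlim : ∀ ε > (0 : ℝ), ⟪w, v⟫ ≤ ε * ‖v‖ := by
    intro ε hε
    obtain ⟨δ, hδ, h⟩ := hw ε hε
    set t := min τ (δ / (‖v‖ + 1)) with ht
    have ht0 : 0 < t := lt_min hτ (by positivity)
    have htv : t * ‖v‖ < δ := by
      calc t * ‖v‖ < t * (‖v‖ + 1) := by gcongr; linarith
        _ ≤ δ / (‖v‖ + 1) * (‖v‖ + 1) := by gcongr; exact min_le_right _ _
        _ = δ := by field_simp
    have hn : ‖((y, ys + t • v) : Eu m × Eu m) - (y, ys)‖ = t * ‖v‖ := by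
      simp [Prod.norm_def, norm_smul, abs_of_pos ht0]
      positivity
    have := h _ (hv t ht0 (min_le_left _ _)) (hn ▸ htv)
    rw [hn] at this
    simp only [sub_self, inner_zero_right, zero_add, add_sub_cancel_left,
      real_inner_smul_right] at this
    refine le_of_mul_le_mul_left ?_ ht0
    linarith
  refine le_of_forall_pos_le_add fun ε hε => ?_
  refine (hlim (ε / (‖v‖ + 1)) (by positivity)).trans ?_
  rw [zero_add, div_mul_eq_mul_div, div_le_iff₀ (by positivity)]
  nlinarith [norm_nonneg v]

theorem inner_eq_zero_of_mem_rnc2 {y ys ws w : Eu m} (hys : (y, ys) ∈ gphN g)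
    (hw : (ws, w) ∈ rnc2 (gphN g) (y, ys)) : ⟪w, ys⟫ = 0 := by
  have key : ∀ s : ℝ, -1 ≤ s → ys + s • ys ∈ rnc (Gam g) y := fun s hs => by
    have := add_smul_mem_rnc hys.2 hys.2 (by linarith : 0 ≤ 1 + s) le_rfl
    simpa [add_smul] using this
  refine le_antisymm (inner_le_of_mem_rnc2 hw one_pos fun t h0 _ =>
    ⟨hys.1, key t (by linarith)⟩) ?_
  have := inner_le_of_mem_rnc2 (v := -ys) hw one_pos fun t _ h1 =>
    ⟨hys.1, by simpa using key (-t) (by linarith)⟩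
  rw [inner_neg_right] at this
  linarith

theorem fderiv_apply_nonpos_of_mem_rnc2 (hg : Differentiable ℝ g) {y ys ws w : Eu m}
    (hys : (y, ys) ∈ gphN g) (hw : (ws, w) ∈ rnc2 (gphN g) (y, ys)) (i : Fin q)
    (hi : g y i = 0) : fderiv ℝ g y w i ≤ 0 := by
  rw [← inner_adjoint_single, real_inner_comm]
  refine inner_le_of_mem_rnc2 hw one_pos fun t h0 _ => ⟨hys.1, ?_⟩
  simpa using add_smul_mem_rnc hys.2 (adjoint_single_mem_rnc hg hi) zero_le_one h0.le

theorem mem_tcone_of_eventually {E : Type*} [NormedAddCommGroup E] [NormedSpace ℝ E] {Ω : Set E}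
    {y w : E}
    (h : ∀ ε > (0 : ℝ), ∀ᶠ t : ℝ in 𝓝[>] 0, ∃ x ∈ Ω, ‖x - (y + t • w)‖ ≤ ε * t) :
    w ∈ tcone Ω y := by
  have hk : ∀ k : ℕ, ∃ t : ℝ, ∃ v : E, 0 < t ∧ t < 1 / ((k : ℝ) + 1) ∧
      ‖v - w‖ ≤ 1 / ((k : ℝ) + 1) ∧ y + t • v ∈ Ω := by
    intro k
    have hpos : (0 : ℝ) < 1 / ((k : ℝ) + 1) := Nat.one_div_pos_of_nat
    obtain ⟨t, ⟨x, hx, hxt⟩, ht0, ht1⟩ :=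
      ((h _ hpos).and (Ioo_mem_nhdsGT hpos)).exists
    refine ⟨t, t⁻¹ • (x - y), ht0, ht1, ?_, ?_⟩
    · have : t⁻¹ • (x - y) - w = t⁻¹ • (x - (y + t • w)) := by
        rw [← sub_sub, smul_sub _ (x - y), inv_smul_smul₀ ht0.ne']
      rw [this, norm_smul, norm_inv, Real.norm_eq_abs, abs_of_pos ht0, inv_mul_le_iff₀ ht0,
        mul_comm]
      exact hxt
    · rwa [smul_inv_smul₀ ht0.ne', add_sub_cancel]
  choose t v h0 h1 h2 h3 using hk
  have hlim := tendsto_one_div_add_atTop_nhds_zero_nat (𝕜 := ℝ)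
  refine ⟨t, v, h0, squeeze_zero (fun k => (h0 k).le) (fun k => (h1 k).le) hlim, ?_, h3⟩
  exact tendsto_iff_norm_sub_tendsto_zero.2 (squeeze_zero (fun _ => norm_nonneg _) h2 hlim)

theorem mem_tcone_Gam (hg : Differentiable ℝ g) {y : Eu m} (hy : y ∈ Gam g) {κ : ℝ}
    (hκ0 : 0 < κ) {W : Set (Eu m)} (hW : W ∈ 𝓝 y)
    (hκ : ∀ z ∈ W, ∀ r : ℝ, 0 < r → (∀ i, g z i ≤ r) → ∃ z' ∈ Gam g, ‖z' - z‖ ≤ κ * r)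
    {w : Eu m} (hw : ∀ i, g y i = 0 → fderiv ℝ g y w i ≤ 0) : w ∈ tcone (Gam g) y := by
  refine mem_tcone_of_eventually fun ε hε => ?_
  have hd : HasDerivAt (fun t : ℝ => y + t • w) w 0 := by
    simpa using ((hasDerivAt_id (0 : ℝ)).smul_const w).const_add y
  have hgd := (hg y).hasFDerivAt.comp_hasDerivAt_of_eq (0 : ℝ) hd (by simp)
  have ho := (hasDerivAt_iff_isLittleO_nhds_zero.1 hgd).def (div_pos hε hκ0)
  have hpos : ∀ᶠ t : ℝ in 𝓝[>] 0, 0 < t := self_mem_nhdsWithin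
  have hp : Tendsto (fun t : ℝ => y + t • w) (𝓝[>] 0) (𝓝 y) := by
    have := hd.continuousAt.tendsto
    simp only [zero_smul, add_zero] at this
    exact this.mono_left nhdsWithin_le_nhds
  have := eventually_exists_mem_Gam_near hg.continuous hy hW hκ hp (r := fun t => ε / κ * t)
    (by filter_upwards [hpos] with t ht; positivity) (by
      filter_upwards [hpos, nhdsWithin_le_nhds ho] with t ht h i hi
      have h1 := (PiLp.norm_apply_le _ i).trans h
      simp only [Function.comp_apply, zero_add, zero_smul, add_zero, PiLp.sub_apply, hi,
        PiLp.smul_apply, smul_eq_mul, sub_zero, Real.norm_eq_abs, abs_of_pos ht] at h1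
      nlinarith [(abs_le.1 h1).2, hw i hi])
  filter_upwards [this] with t ⟨x, hx, hxt⟩
  refine ⟨x, hx, hxt.trans_eq ?_⟩
  field_simp

theorem inner_eq_sum (l v : Eu q) : ⟪l, v⟫ = ∑ i, l i * v i := by
  simp [PiLp.inner_apply, mul_comm]

theorem inner_apply_eq_zero_of_mem_Gam {y ys : Eu m} {l : Eu q} (hl : l ∈ Lam g y ys) :
    ⟪l, g y⟫ = 0 := by
  rw [inner_eq_sum]
  refine Finset.sum_eq_zero fun i _ => ?_
  by_cases hi : g y i = 0
  · simp [hi]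
  · simp [hl.2.2 i hi]

theorem exists_second_order_direction (hg : ContDiff ℝ 2 g) {y ys w : Eu m} {l : Eu q}
    (hl : l ∈ dirLam g y ys w) {δ : ℝ} (hδ : 0 < δ) :
    ∃ z : Eu m,
      (∀ i, g y i = 0 → (fderiv ℝ (fderiv ℝ g) y w w + fderiv ℝ g y z) i ≤ δ) ∧
      -δ ≤ ⟪l, fderiv ℝ (fderiv ℝ g) y w w + fderiv ℝ g y z⟫ := by
  classical
  set b : Fin q → Eu m := fun i =>
    ContinuousLinearMap.adjoint (fderiv ℝ g y) (EuclideanSpace.single i 1) with hb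
  set Q := fderiv ℝ (fderiv ℝ g) y w w with hQ
  have hl0 := hl.1.2.2
  obtain ⟨z, hz, hz'⟩ := exists_approx_dual_of_isMax
    (fun i => if g y i = 0 then b i else 0) (fun i => if g y i = 0 then Q i else 0) l hl.1.1
    (fun l' hl' hsum => by
      set l'' : Eu q := WithLp.toLp 2 fun i => if g y i = 0 then l' i else 0 with hl''
      have hmem : l'' ∈ Lam g y ys := by
        refine ⟨fun i => ?_, ?_, fun i hi => by simp [hl'', hi]⟩
        · simp only [hl'']
          split_ifs
          exacts [hl' i, le_rfl]
        · rw [← hl.1.2.1, adjoint_eq_sum, adjoint_eq_sum _ l]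
          convert hsum using 2 with i _ i _
          · by_cases hi : g y i = 0 <;> simp [hl'', hi, hb]
          · by_cases hi : g y i = 0
            · simp [hi, hb]
            · simp [hl0 i hi]
      have := hl.2 l'' hmem
      rw [inner_hessA hg, inner_hessA hg, inner_eq_sum, inner_eq_sum, ← hQ] at this
      convert this using 2 with i _ i _
      · by_cases hi : g y i = 0 <;> simp [hl'', hi]
      · by_cases hi : g y i = 0
        · simp [hi]
        · simp [hl0 i hi]) hδ
  refine ⟨z, fun i hi => ?_, ?_⟩
  · have := hz i
    simp only [hi, if_true, hb, inner_adjoint_single] at this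
    rw [PiLp.add_apply]
    linarith
  · rw [inner_eq_sum]
    convert hz' using 2 with i _
    by_cases hi : g y i = 0
    · simp only [hi, if_true, hb, inner_adjoint_single, PiLp.add_apply]
      ring
    · simp [hl0 i hi]

theorem eventually_exists_approx_max (hg : ContDiff ℝ 2 g) {y : Eu m} (hy : y ∈ Gam g) {κ : ℝ}
    (hκ0 : 0 < κ) {W : Set (Eu m)} (hW : W ∈ 𝓝 y)
    (hκ : ∀ z ∈ W, ∀ r : ℝ, 0 < r → (∀ i, g z i ≤ r) → ∃ z' ∈ Gam g, ‖z' - z‖ ≤ κ * r)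
    {ys w : Eu m} {l : Eu q} (hl : l ∈ dirLam g y ys w) (hys : ⟪w, ys⟫ = 0)
    (hw : ∀ i, g y i = 0 → fderiv ℝ g y w i ≤ 0) {ε : ℝ} (hε : 0 < ε) :
    ∀ᶠ t : ℝ in 𝓝[>] 0, ∃ x ∈ Gam g, ‖x - (y + t • w)‖ ≤ ε * t ∧ -(ε * t ^ 2) ≤ ⟪l, g x⟫ := by
  have hh : ContDiff ℝ 2 fun x => ⟪l, g x⟫ := contDiff_const.inner ℝ hg
  obtain ⟨K, U, hU, hK⟩ :=
    (hh.of_le (by norm_num : (1 : WithTop ℕ∞) ≤ 2)).contDiffAt.exists_lipschitzOnWith (x := y)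
  obtain ⟨ρ, hρ, hρU⟩ := Metric.mem_nhds_iff.1 hU
  set δ : ℝ := ε / (1 + ‖l‖ + K * κ) with hδ
  have hden : 0 < 1 + ‖l‖ + K * κ := by positivity
  have hδ0 : 0 < δ := by positivity
  obtain ⟨z, hz, hz'⟩ := exists_second_order_direction hg hl hδ0
  set R := fderiv ℝ (fderiv ℝ g) y w w + fderiv ℝ g y z with hR
  set p : ℝ → Eu m := fun t => y + t • w + (t ^ 2 / 2) • z with hp
  have hpc : Continuous p := by fun_prop
  have hp0 : p 0 = y := by simp [hp]
  have hplim : Tendsto p (𝓝[>] 0) (𝓝 y) := hp0 ▸ hpc.continuousAt.tendsto.mono_left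
    nhdsWithin_le_nhds
  have hpos : ∀ᶠ t : ℝ in 𝓝[>] 0, 0 < t := self_mem_nhdsWithin
  have hrem := (isLittleO_sq_comp_quadratic hg y w z).def (half_pos hδ0)
  have hyw : ⟪l, fderiv ℝ g y w⟫ = 0 := by
    rw [← ContinuousLinearMap.adjoint_inner_left, hl.1.2.1, real_inner_comm, hys]
  have hnear := eventually_exists_mem_Gam_near hg.continuous hy hW hκ hplim
    (r := fun t => δ * t ^ 2) (by filter_upwards [hpos] with t ht; positivity) (by
      filter_upwards [hpos, nhdsWithin_le_nhds hrem] with t ht h i hi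
      have h1 := (PiLp.norm_apply_le _ i).trans h
      simp only [PiLp.sub_apply, hi, PiLp.smul_apply, smul_eq_mul, sub_zero,
        Real.norm_eq_abs, abs_of_nonneg (sq_nonneg t)] at h1
      have h2 := (abs_le.1 h1).2
      have h3 := mul_nonneg (sq_nonneg t) (sub_nonneg.2 (hz i hi))
      simp only [hp]
      nlinarith [hw i hi])
  have hsmall1 : ∀ᶠ t : ℝ in 𝓝[>] 0, ‖p t - y‖ + κ * (δ * t ^ 2) < ρ := by
    have hc : Continuous fun t : ℝ => ‖p t - y‖ + κ * (δ * t ^ 2) := by fun_prop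
    exact nhdsWithin_le_nhds (hc.continuousAt.eventually_lt_const (by simpa [hp0] using hρ))
  have hsmall2 : ∀ᶠ t : ℝ in 𝓝[>] 0, t * (κ * δ + ‖z‖ / 2) < ε := by
    have hc : Continuous fun t : ℝ => t * (κ * δ + ‖z‖ / 2) := by fun_prop
    exact nhdsWithin_le_nhds (hc.continuousAt.eventually_lt_const (by simpa using hε))
  filter_upwards [hpos, hnear, hsmall1, hsmall2, nhdsWithin_le_nhds hrem]
    with t ht ⟨x, hx, hxp⟩ h1 h2 h3
  refine ⟨x, hx, ?_, ?_⟩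
  · have h4 : x - (y + t • w) = (x - p t) + (t ^ 2 / 2) • z := by simp only [hp]; abel
    rw [h4]
    refine (norm_add_le _ _).trans ?_
    rw [norm_smul, Real.norm_of_nonneg (by positivity)]
    nlinarith
  · have hpU : p t ∈ U := hρU (by
      rw [mem_ball_iff_norm]
      have : 0 ≤ κ * (δ * t ^ 2) := by positivity
      linarith)
    have hxU : x ∈ U := hρU (by
      rw [mem_ball_iff_norm]
      have := norm_sub_le_norm_sub_add_norm_sub x (p t) y
      linarith)
    have hLip := hK.dist_le_mul _ hxU _ hpU
    rw [Real.dist_eq, dist_eq_norm] at hLip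
    have h5 := (abs_le.1 hLip).1
    have h6 : (K : ℝ) * ‖x - p t‖ ≤ K * (κ * (δ * t ^ 2)) := by gcongr
    have h7 := (abs_real_inner_le_norm l _).trans (mul_le_mul_of_nonneg_left h3 (norm_nonneg l))
    rw [inner_sub_right, inner_sub_right, inner_sub_right, real_inner_smul_right,
      real_inner_smul_right, hyw, inner_apply_eq_zero_of_mem_Gam hl.1,
      Real.norm_of_nonneg (sq_nonneg t)] at h7
    have h8 := (abs_le.1 h7).1
    have h9 : δ * (1 + ‖l‖ + K * κ) * t ^ 2 = ε * t ^ 2 := by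
      rw [hδ, div_mul_cancel₀ _ hden.ne']
    have h10 := mul_le_mul_of_nonneg_left hz' (by positivity : 0 ≤ t ^ 2 / 2)
    have h11 : 0 ≤ δ * ‖l‖ * t ^ 2 := by positivity
    have h12 : 0 ≤ δ * t ^ 2 := by positivity
    change ⟪l, g (p t)⟫ - _ - _ - _ ≥ _ at h8
    linarith

/-- The curve `(y + t • w, ys + t • hessA g l y w)` is tangent to the graph of the normal cone map:
the graph points come from maximizing `⟪l, g z⟫ - ‖z - (y + t • w)‖ ^ 2 / 2` over `Γ` near `y`. -/
theorem eventually_exists_graph_point (hg : ContDiff ℝ 2 g) {y : Eu m} (hy : y ∈ Gam g) {κ : ℝ}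
    (hκ0 : 0 < κ) {W : Set (Eu m)} (hW : W ∈ 𝓝 y)
    (hκ : ∀ z ∈ W, ∀ r : ℝ, 0 < r → (∀ i, g z i ≤ r) → ∃ z' ∈ Gam g, ‖z' - z‖ ≤ κ * r)
    {ys w : Eu m} {l : Eu q} (hl : l ∈ dirLam g y ys w) (hys : ⟪w, ys⟫ = 0)
    (hw : ∀ i, g y i = 0 → fderiv ℝ g y w i ≤ 0) {ε : ℝ} (hε : 0 < ε) :
    ∀ᶠ t : ℝ in 𝓝[>] 0, ∃ z : Eu m, ‖z - (y + t • w)‖ ≤ ε * t ∧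
      (z, ContinuousLinearMap.adjoint (fderiv ℝ g z) l - (z - (y + t • w))) ∈ gphN g := by
  set η : ℝ := min 1 (ε ^ 2 / 3) with hη
  have hη0 : 0 < η := by positivity
  have hη1 : 2 * η + η ^ 2 ≤ ε ^ 2 := by
    have h1 : η ≤ 1 := min_le_left _ _
    have h2 : η ≤ ε ^ 2 / 3 := min_le_right _ _
    nlinarith
  have hpos : ∀ᶠ t : ℝ in 𝓝[>] 0, 0 < t := self_mem_nhdsWithin
  have hsmall : ∀ a : ℝ, ∀ᶠ t : ℝ in 𝓝[>] 0, t * a < 1 := fun a => by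
    have hc : Continuous fun t : ℝ => t * a := by fun_prop
    exact nhdsWithin_le_nhds (hc.continuousAt.eventually_lt_const (by simp))
  have hclosed : IsClosed (Gam g) := by
    have := hg.continuous
    simp only [Gam, Set.ofPred_forall]
    exact isClosed_iInter fun i => isClosed_le (by fun_prop) continuous_const
  filter_upwards [hpos, eventually_exists_approx_max hg hy hκ0 hW hκ hl hys hw hη0,
    hsmall (η + ‖w‖), hsmall (ε + ‖w‖)] with t ht ⟨x, hx, hxp, hxl⟩ h1 h2
  set p := y + t • w with hp
  have hball : ∀ u a, ‖u - p‖ ≤ a * t → t * (a + ‖w‖) < 1 → ‖u - y‖ < 1 := by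
    intro u a hu ha
    have h3 : u - y = (u - p) + t • w := by simp only [hp]; abel
    rw [h3]
    refine (norm_add_le _ _).trans_lt ?_
    rw [norm_smul, Real.norm_of_nonneg ht.le]
    linarith
  set φ : Eu m → ℝ := fun u => ⟪l, g u⟫ - ‖u - p‖ ^ 2 / 2 with hφ
  have hφc : Continuous φ := by
    have := hg.continuous
    fun_prop
  obtain ⟨z, ⟨hzΓ, hzb⟩, hzmax⟩ := ((isCompact_closedBall y 1).inter_left hclosed).exists_isMaxOn
    ⟨x, hx, by rw [mem_closedBall_iff_norm]; exact (hball x η hxp h1).le⟩ hφc.continuousOn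
  have hzx : φ x ≤ φ z := hzmax ⟨hx, by
    rw [mem_closedBall_iff_norm]; exact (hball x η hxp h1).le⟩
  have hlz : ⟪l, g z⟫ ≤ 0 := by
    rw [inner_eq_sum]
    exact Finset.sum_nonpos fun i _ => mul_nonpos_of_nonneg_of_nonpos (hl.1.1 i) (hzΓ i)
  have hzp : ‖z - p‖ ≤ ε * t := by
    refine le_of_sq_le_sq ?_ (by positivity)
    simp only [hφ] at hzx
    have h3 : ‖x - p‖ ^ 2 ≤ (η * t) ^ 2 := by gcongr
    have h4 := mul_le_mul_of_nonneg_right hη1 (sq_nonneg t)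
    linarith
  refine ⟨z, hzp, hzΓ, mem_rnc_of_isLocalMaxOn (φ := φ) ?_ ?_⟩
  · have h3 := ((hasFDerivAt_id z).sub_const p).norm_sq.const_mul (1 / 2 : ℝ)
    have h4 := (hasFDerivAt_inner_comp (hg.differentiable (by norm_num)) l z).sub h3
    have h5 : φ = (fun u => ⟪l, g u⟫) - fun u => 1 / 2 * ‖id u - p‖ ^ 2 := by
      ext u
      simp only [hφ, Pi.sub_apply, id]
      ring
    rw [h5]
    refine h4.congr_fderiv ?_
    ext u
    simp
  · have hzU : Metric.ball y 1 ∈ 𝓝 z := Metric.isOpen_ball.mem_nhds (by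
      rw [mem_ball_iff_norm]; exact hball z ε hzp h2)
    filter_upwards [self_mem_nhdsWithin, nhdsWithin_le_nhds hzU] with u hu hub
    exact hzmax ⟨hu, Metric.ball_subset_closedBall hub⟩

theorem inner_add_inner_hessA_nonpos (hg : ContDiff ℝ 2 g) {y ys ws w : Eu m} {l : Eu q}
    (hl : ContinuousLinearMap.adjoint (fderiv ℝ g y) l = ys)
    (hw : (ws, w) ∈ rnc2 (gphN g) (y, ys))
    (h : ∀ ε > (0 : ℝ), ∀ᶠ t : ℝ in 𝓝[>] 0, ∃ z : Eu m, ‖z - (y + t • w)‖ ≤ ε * t ∧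
      (z, ContinuousLinearMap.adjoint (fderiv ℝ g z) l - (z - (y + t • w))) ∈ gphN g) :
    ⟪ws, w⟫ + ⟪w, hessA g l y w⟫ ≤ 0 := by
  set G' := fderiv ℝ (fun x => ContinuousLinearMap.adjoint (fderiv ℝ g x) l) y with hG'
  set H := hessA g l y w with hH
  set C₁ := ‖G'‖ + 2 + ‖w‖ with hC₁
  set C := ‖ws‖ + ‖w‖ * C₁ + (1 + ‖w‖ + C₁ + ‖H‖) with hC
  have hC₁0 : 0 ≤ C₁ := by positivity
  have hC0 : 0 < C := by positivity
  have key : ∀ ε : ℝ, 0 < ε → ε ≤ 1 → ⟪ws, w⟫ + ⟪w, H⟫ ≤ ε * C := by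
    intro ε hε hε1
    obtain ⟨δ, hδ, hn⟩ := hw ε hε
    obtain ⟨ρ, hρ, hrem⟩ := Metric.eventually_nhds_iff_ball.1
      ((hasFDerivAt_adjoint_fderiv hg l y).isLittleO.def hε)
    have hpos : ∀ᶠ t : ℝ in 𝓝[>] 0, 0 < t := self_mem_nhdsWithin
    have hsmall : ∀ᶠ t : ℝ in 𝓝[>] 0, t * (1 + ‖w‖ + C₁ + ‖H‖) < min δ ρ := by
      have hc : Continuous fun t : ℝ => t * (1 + ‖w‖ + C₁ + ‖H‖) := by fun_prop
      exact nhdsWithin_le_nhds (hc.continuousAt.eventually_lt_const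
        (by simpa using lt_min hδ hρ))
    obtain ⟨t, ⟨ht, hts⟩, z, hz, hzg⟩ := ((hpos.and hsmall).and (h ε hε)).exists
    set e₁ := z - (y + t • w) with he₁
    set zs := ContinuousLinearMap.adjoint (fderiv ℝ g z) l - e₁ with hzs
    have hzy : z - y = t • w + e₁ := by simp only [he₁]; abel
    have htε : ε * t ≤ t := by nlinarith
    have hzyn : ‖z - y‖ ≤ t * (1 + ‖w‖) := by
      rw [hzy]
      refine (norm_add_le _ _).trans ?_
      rw [norm_smul, Real.norm_of_nonneg ht.le]
      linarith
    have hB : t * (1 + ‖w‖) ≤ t * (1 + ‖w‖ + C₁ + ‖H‖) :=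
      mul_le_mul_of_nonneg_left (by linarith [norm_nonneg H]) ht.le
    have hr := hrem z (by
      rw [mem_ball_iff_norm]
      exact (hzyn.trans hB).trans_lt (hts.trans_le (min_le_right _ _)))
    rw [← hG', hl] at hr
    set e₂ := zs - ys - t • H with he₂
    have he₂n : ‖e₂‖ ≤ ε * t * C₁ := by
      have h1 : e₂ = (ContinuousLinearMap.adjoint (fderiv ℝ g z) l - ys - G' (z - y))
          + G' e₁ - e₁ := by
        have h2 : G' (z - y) = t • H + G' e₁ := by rw [hzy, map_add, map_smul, hH]; rfl
        rw [h2, he₂, hzs]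
        abel
      rw [h1]
      refine (norm_sub_le _ _).trans ((add_le_add_left (norm_add_le _ _) _).trans ?_)
      have h3 := G'.le_opNorm e₁
      have h4 : ‖G'‖ * ‖e₁‖ ≤ ‖G'‖ * (ε * t) := by gcongr
      have h5 : ε * ‖z - y‖ ≤ ε * (t * (1 + ‖w‖)) := by gcongr
      rw [hC₁]
      linarith
    have hzsy : zs - ys = t • H + e₂ := by rw [he₂]; abel
    have hzsn : ‖zs - ys‖ ≤ t * (C₁ + ‖H‖) := by
      rw [hzsy]
      refine (norm_add_le _ _).trans ?_
      rw [norm_smul, Real.norm_of_nonneg ht.le]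
      have := mul_le_mul_of_nonneg_right htε hC₁0
      linarith
    have hnorm : ‖((z, zs) : Eu m × Eu m) - (y, ys)‖ ≤ t * (1 + ‖w‖ + C₁ + ‖H‖) := by
      rw [Prod.mk_sub_mk, Prod.norm_mk]
      refine max_le (hzyn.trans hB) (hzsn.trans ?_)
      gcongr
      linarith [norm_nonneg w]
    have hfin := (hn _ hzg (hnorm.trans_lt (hts.trans_le (min_le_left _ _)))).trans
      (mul_le_mul_of_nonneg_left hnorm hε.le)
    simp only [hzy, hzsy, inner_add_right, real_inner_smul_right] at hfin
    have h6 := (abs_le.1 ((abs_real_inner_le_norm ws e₁).trans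
      (mul_le_mul_of_nonneg_left hz (norm_nonneg _)))).1
    have h7 := (abs_le.1 ((abs_real_inner_le_norm w e₂).trans
      (mul_le_mul_of_nonneg_left he₂n (norm_nonneg _)))).1
    refine le_of_mul_le_mul_left ?_ ht
    rw [hC]
    linarith
  refine le_of_forall_pos_le_add fun ε hε => ?_
  refine (key (min 1 (ε / C)) (by positivity) (min_le_left _ _)).trans ?_
  rw [zero_add, ← le_div_iff₀ hC0]
  exact min_le_right _ _

end System

/-- under MSCQ for `g(y) ≤ 0` at `ȳ ∈ Γ`, there is a neighborhood `V` of
`ȳ` such that for every `(y, y*) ∈ gph N̂_Γ` with `y ∈ V` and every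
`(w*, w) ∈ N̂_{gph N̂_Γ}(y, y*)` one has `w ∈ K(y, y*)` and
`⟨w*, w⟩ + wᵀ∇²(λᵀg)(y)w ≤ 0` for every `λ ∈ Λ(y, y*; w)`. -/
theorem stmt_16 {m q : ℕ} (g : Eu m → Eu q) (hg : ContDiff ℝ 2 g)
    (yb : Eu m) (hyb : yb ∈ Gam g) (hMSCQ : MSCQlow g yb) :
    ∃ V ∈ 𝓝 yb, ∀ y ys : Eu m, y ∈ V → (y, ys) ∈ gphN g →
      ∀ ws w : Eu m, (ws, w) ∈ rnc2 (gphN g) (y, ys) →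
        w ∈ Kcone g y ys ∧
        ∀ l ∈ dirLam g y ys w, ⟪ws, w⟫ + ⟪w, hessA g l y w⟫ ≤ 0 := by
  obtain ⟨κ, hκ0, W, hW, hκ⟩ := hMSCQ.exists_error_bound
  refine ⟨interior W, interior_mem_nhds.2 hW, fun y ys hy hys ws w hw => ?_⟩
  have hWy := mem_interior_iff_mem_nhds.1 hy
  have hd := hg.differentiable (by norm_num)
  have h0 := inner_eq_zero_of_mem_rnc2 hys hw
  have hlin := fderiv_apply_nonpos_of_mem_rnc2 hd hys hw
  exact ⟨⟨mem_tcone_Gam hd hys.1 hκ0 hWy hκ hlin, h0⟩, fun l hl =>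
    inner_add_inner_hessA_nonpos hg hl.1.2.1 hw fun ε hε =>
      eventually_exists_graph_point hg hys.1 hκ0 hWy hκ hl h0 hlin hε⟩
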